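/- arXiv:1009.2110 — 2 statements merged into one kernel-verified Lean document; each statement's English description precedes it below -/
import Mathlib

section
/- Let m ≥ 1 and let φ : ℝ^m × ℝ^m → ℝ be three times continuously differentiable in a neighborhood of (0,0), with points written (x,y), x,y ∈ ℝ^m. Assume φ(x,0) = 0 for all x near 0, that the total derivative of φ vanishes at every point (x,0) near 0, and that the Hessian matrix H = (∂²φ/∂y_j∂y_k(0,0)) is positive definite. Then there exists an invertible real m×m matrix A such that, under the identification ℂ^m ≅ ℝ^m × ℝ^m via z = x + iy and letting A act ℂ-linearly on ℂ^m (componentwise on x and y), one has φ(Az) = Σ_{j=1}^m (Im z_j)² + O(‖z‖³) as z → 0; that is, there exist constants K, r > 0 with |φ(Az) − Σ_j (Im z_j)²| ≤ K‖z‖³ for all ‖z‖ < r. -/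
open Topology Asymptotics

/-- A function vanishing at `0` whose derivative is `O(‖x‖ⁿ)` is itself `O(‖x‖ⁿ⁺¹)`. -/
theorem isBigO_norm_pow_succ_of_hasFDerivAt {E F : Type*} [NormedAddCommGroup E] [NormedSpace ℝ E]
    [NormedAddCommGroup F] [NormedSpace ℝ F] {f : E → F} {f' : E → E →L[ℝ] F} {n : ℕ}
    (hf : ∀ᶠ x in 𝓝 0, HasFDerivAt f (f' x) x) (hf' : f' =O[𝓝 0] fun x => ‖x‖ ^ n)
    (h0 : f 0 = 0) : f =O[𝓝 0] fun x => ‖x‖ ^ (n + 1) := by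
  obtain ⟨C, hC, hC'⟩ := hf'.exists_nonneg
  obtain ⟨r, hr, h⟩ := Metric.eventually_nhds_iff_ball.1 (hf.and hC'.bound)
  refine IsBigO.of_bound C (Metric.eventually_nhds_iff_ball.2 ⟨r, hr, fun x hx => ?_⟩)
  have hsub : ∀ y ∈ Metric.closedBall (0 : E) ‖x‖, ‖y‖ ≤ ‖x‖ ∧ y ∈ Metric.ball (0 : E) r := by
    intro y hy
    rw [mem_closedBall_zero_iff] at hy
    rw [mem_ball_zero_iff] at hx ⊢
    exact ⟨hy, hy.trans_lt hx⟩
  have key := (convex_closedBall (0 : E) ‖x‖).norm_image_sub_le_of_norm_hasFDerivWithin_le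
    (f := f) (f' := f') (C := C * ‖x‖ ^ n) (x := 0) (y := x)
    (fun y hy => (h y (hsub y hy).2).1.hasFDerivWithinAt)
    (fun y hy => (h y (hsub y hy).2).2.trans ?_) (by simp) (by simp)
  · rw [h0, sub_zero, sub_zero] at key
    simpa [pow_succ, mul_assoc] using key
  · rw [norm_pow, norm_norm]
    gcongr
    exact (hsub y hy).1

/-- Second-order Taylor expansion at `0` with cubic remainder. -/
theorem ContDiffAt.isBigO_taylor_two {E : Type*} [NormedAddCommGroup E] [NormedSpace ℝ E]
    {f : E → ℝ} (hf : ContDiffAt ℝ 3 f 0) :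
    (fun p => f p - f 0 - fderiv ℝ f 0 p - (1 / 2 : ℝ) * fderiv ℝ (fderiv ℝ f) 0 p p)
      =O[𝓝 0] fun p => ‖p‖ ^ 3 := by
  have hf1 : ContDiffAt ℝ 2 (fderiv ℝ f) 0 := hf.fderiv_right (by norm_num)
  have hf2 : ContDiffAt ℝ 1 (fderiv ℝ (fderiv ℝ f)) 0 := hf1.fderiv_right (by norm_num)
  set B := fderiv ℝ (fderiv ℝ f) 0
  have hsymm : ∀ v w, B v w = B w v := hf.isSymmSndFDerivAt (by simp; norm_num)
  have hB : (fun p => fderiv ℝ (fderiv ℝ f) p - B) =O[𝓝 0] fun p => ‖p‖ ^ 1 := by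
    simpa using (hf2.differentiableAt (by norm_num)).isBigO_sub.norm_right
  have hg : (fun p => fderiv ℝ f p - fderiv ℝ f 0 - B p) =O[𝓝 0] fun p => ‖p‖ ^ 2 := by
    refine isBigO_norm_pow_succ_of_hasFDerivAt ?_ hB (by simp)
    filter_upwards [hf1.eventually (by simp)] with p hp
    exact ((hp.differentiableAt (by norm_num)).hasFDerivAt.sub_const _).sub B.hasFDerivAt
  refine isBigO_norm_pow_succ_of_hasFDerivAt ?_ hg (by simp)
  filter_upwards [hf.eventually (by simp)] with p hp
  have hq : HasFDerivAt (fun p => (1 / 2 : ℝ) * B p p) (B p) p := by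
    refine ((B.hasFDerivAt.clm_apply (hasFDerivAt_id p)).const_mul (1 / 2 : ℝ)).congr_fderiv ?_
    ext v
    simp [hsymm v p]
    ring
  exact (((hp.differentiableAt (by norm_num)).hasFDerivAt.sub_const _).sub
    (fderiv ℝ f 0).hasFDerivAt).sub hq

open scoped MatrixOrder Matrix in
/-- A positive definite real matrix is congruent to twice the identity. -/
theorem Matrix.PosDef.exists_transpose_mul_mul_eq_two {n : Type*} [Fintype n] [DecidableEq n]
    {H : Matrix n n ℝ} (hH : H.PosDef) :
    ∃ A : Matrix n n ℝ, A.det ≠ 0 ∧ Aᵀ * H * A = (2 : ℝ) • (1 : Matrix n n ℝ) := by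
  obtain ⟨B, hB, rfl⟩ := CStarAlgebra.isStrictlyPositive_iff_eq_star_mul_self.mp
    hH.isStrictlyPositive
  have hdet : IsUnit B.det := (Matrix.isUnit_iff_isUnit_det B).1 hB
  refine ⟨√2 • B⁻¹, ?_, ?_⟩
  · rw [Matrix.det_smul, Matrix.det_nonsing_inv]
    exact mul_ne_zero (by positivity) hdet.ringInverse.ne_zero
  · have h1 : B * B⁻¹ = 1 := Matrix.mul_nonsing_inv B hdet
    have h2 : B⁻¹ᵀ * Bᵀ = 1 := by rw [← Matrix.transpose_mul, h1, Matrix.transpose_one]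
    rw [Matrix.star_eq_conjTranspose, Matrix.conjTranspose_eq_transpose_of_trivial,
      Matrix.transpose_smul, Matrix.smul_mul, Matrix.smul_mul, Matrix.mul_smul, smul_smul,
      Real.mul_self_sqrt (by norm_num), Matrix.mul_assoc, Matrix.mul_assoc, h1, Matrix.mul_one, h2]

open scoped Matrix in
/-- A bilinear form on `n → ℝ` evaluated through its Gram matrix in the standard basis. -/
theorem bilin_apply_eq_dotProduct_mulVec {n : Type*} [Fintype n] [DecidableEq n]
    (b : (n → ℝ) →ₗ[ℝ] (n → ℝ) →ₗ[ℝ] ℝ) (v w : n → ℝ) :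
    b v w = v ⬝ᵥ (Matrix.of fun j k => b (Pi.single j 1) (Pi.single k 1)) *ᵥ w := by
  conv_lhs => rw [← Matrix.toLinearMap₂'_toMatrix' (R := ℝ) b]
  rw [Matrix.toLinearMap₂'_apply']
  rfl

/-- The sup norm on `ℝᵐ × ℝᵐ` is dominated by the Euclidean one. -/
theorem norm_prod_pi_le_sqrt {n : Type*} [Fintype n] (x y : n → ℝ) :
    ‖(x, y)‖ ≤ √(∑ j, (x j ^ 2 + y j ^ 2)) := by
  have hle : ∀ i, x i ^ 2 + y i ^ 2 ≤ ∑ j, (x j ^ 2 + y j ^ 2) := fun i =>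
    Finset.single_le_sum (f := fun j => x j ^ 2 + y j ^ 2) (fun j _ => by positivity)
      (Finset.mem_univ i)
  refine max_le ((pi_norm_le_iff_of_nonneg (Real.sqrt_nonneg _)).2 fun i => ?_)
    ((pi_norm_le_iff_of_nonneg (Real.sqrt_nonneg _)).2 fun i => ?_) <;>
  · refine Real.abs_le_sqrt ((hle i).trans' ?_)
    nlinarith [sq_nonneg (x i), sq_nonneg (y i)]

/-- If the derivative of `f` vanishes along a subspace, its second derivative kills that
subspace. -/
theorem fderiv_fderiv_apply_inl_eq_zero {E F : Type*} [NormedAddCommGroup E] [NormedSpace ℝ E]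
    [NormedAddCommGroup F] [NormedSpace ℝ F] {f : E × F → ℝ}
    (hf : DifferentiableAt ℝ (fderiv ℝ f) 0)
    (h : ∀ᶠ p in 𝓝 (0 : E × F), p.2 = 0 → fderiv ℝ f p = 0) (x : E) :
    fderiv ℝ (fderiv ℝ f) 0 (x, 0) = 0 := by
  have hinl : HasFDerivAt (fun x : E => (x, (0 : F))) (ContinuousLinearMap.inl ℝ E F) 0 :=
    (ContinuousLinearMap.inl ℝ E F).hasFDerivAt
  have h1 : HasFDerivAt (fun x : E => fderiv ℝ f (x, 0))
      ((fderiv ℝ (fderiv ℝ f) 0).comp (ContinuousLinearMap.inl ℝ E F)) 0 :=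
    HasFDerivAt.comp (0 : E) (g := fderiv ℝ f) hf.hasFDerivAt hinl
  have h2 : (fun x : E => fderiv ℝ f (x, 0)) =ᶠ[𝓝 0] fun _ => 0 :=
    (hinl.continuousAt.eventually h).mono fun _ hx => hx rfl
  have h3 := h1.unique ((hasFDerivAt_const 0 (0 : E)).congr_of_eventuallyEq h2)
  simpa using DFunLike.congr_fun h3 x


/-- Local normal form of the Grauert-tube gauge function.  Let `φ : ℝᵐ × ℝᵐ → ℝ` be `C³`
near `(0,0)`, with `φ (x, 0) = 0` and `Dφ (x, 0) = 0` for all `x` near `0`, and with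
positive definite Hessian `H = (∂²φ/∂yⱼ∂yₖ (0,0))`.  Then there is an invertible real
matrix `A` such that, identifying `ℂᵐ ≅ ℝᵐ × ℝᵐ` via `z = x + i y` and letting `A` act
componentwise, `φ (A z) = ∑ⱼ (Im zⱼ)² + O(‖z‖³)` as `z → 0`. -/
theorem stmt9 {m : ℕ} (hm : 1 ≤ m)
    (φ : (Fin m → ℝ) × (Fin m → ℝ) → ℝ)
    (U : Set ((Fin m → ℝ) × (Fin m → ℝ)))
    (hU : IsOpen U) (h0 : ((0, 0) : (Fin m → ℝ) × (Fin m → ℝ)) ∈ U)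
    (hφ : ContDiffOn ℝ 3 φ U)
    (hvan : ∀ p ∈ U, p.2 = 0 → φ p = 0)
    (hgrad : ∀ p ∈ U, p.2 = 0 → fderiv ℝ φ p = 0)
    (hH : (Matrix.of fun j k : Fin m =>
      fderiv ℝ (fderiv ℝ φ) (0, 0) (0, Pi.single j 1) (0, Pi.single k 1)).PosDef) :
    ∃ A : Matrix (Fin m) (Fin m) ℝ, A.det ≠ 0 ∧
      ∃ K r : ℝ, 0 < K ∧ 0 < r ∧
        ∀ x y : Fin m → ℝ, Real.sqrt (∑ j, ((x j) ^ 2 + (y j) ^ 2)) < r →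
          |φ (A.mulVec x, A.mulVec y) - ∑ j, (y j) ^ 2| ≤
            K * Real.sqrt (∑ j, ((x j) ^ 2 + (y j) ^ 2)) ^ 3 := by
  have hUn : U ∈ 𝓝 (0 : (Fin m → ℝ) × (Fin m → ℝ)) := hU.mem_nhds h0
  have hc : ContDiffAt ℝ 3 φ 0 := hφ.contDiffAt hUn
  have hc1 : ContDiffAt ℝ 2 (fderiv ℝ φ) 0 := hc.fderiv_right (by norm_num)
  have htaylor := hc.isBigO_taylor_two
  rw [hvan 0 h0 rfl, hgrad 0 h0 rfl] at htaylor
  have hsymm : ∀ v w, fderiv ℝ (fderiv ℝ φ) 0 v w = fderiv ℝ (fderiv ℝ φ) 0 w v :=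
    hc.isSymmSndFDerivAt (by simp; norm_num)
  have hker : ∀ x : Fin m → ℝ, fderiv ℝ (fderiv ℝ φ) 0 (x, 0) = 0 :=
    fderiv_fderiv_apply_inl_eq_zero (hc1.differentiableAt (by norm_num))
      (Filter.eventually_of_mem hUn hgrad)
  have hprod : ((0, 0) : (Fin m → ℝ) × (Fin m → ℝ)) = 0 := rfl
  rw [hprod] at hH
  set B := fderiv ℝ (fderiv ℝ φ) 0
  have hquad : ∀ x y : Fin m → ℝ, B (x, y) (x, y) = B (0, y) (0, y) := by
    intro x y
    have hxy : (x, y) = (x, (0 : Fin m → ℝ)) + ((0 : Fin m → ℝ), y) := by simp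
    rw [hxy]
    simp only [map_add, hker, zero_add, hsymm (0, y) (x, 0), zero_apply]
  obtain ⟨A, hA, hAH⟩ := hH.exists_transpose_mul_mul_eq_two
  refine ⟨A, hA, ?_⟩
  have hBA : ∀ y : Fin m → ℝ, B (0, A.mulVec y) (0, A.mulVec y) = 2 * ∑ j, y j ^ 2 := by
    intro y
    have h := bilin_apply_eq_dotProduct_mulVec
      ((B.toLinearMap₁₂).compl₁₂ (LinearMap.inr ℝ (Fin m → ℝ) (Fin m → ℝ))
        (LinearMap.inr ℝ (Fin m → ℝ) (Fin m → ℝ))) (A.mulVec y) (A.mulVec y)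
    refine h.trans ?_
    change A.mulVec y ⬝ᵥ (Matrix.of fun j k : Fin m =>
      B (0, Pi.single j 1) (0, Pi.single k 1)).mulVec (A.mulVec y) = _
    rw [dotProduct_comm, Matrix.dotProduct_mulVec, ← Matrix.mulVec_transpose, dotProduct_comm,
      Matrix.mulVec_mulVec, Matrix.mulVec_mulVec, hAH, Matrix.smul_mulVec,
      Matrix.one_mulVec, dotProduct_smul, smul_eq_mul]
    simp [dotProduct, sq]
  let L : (Fin m → ℝ) × (Fin m → ℝ) →L[ℝ] (Fin m → ℝ) × (Fin m → ℝ) :=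
    (LinearMap.prodMap A.mulVecLin A.mulVecLin).toContinuousLinearMap
  have hL : Filter.Tendsto L (𝓝 0) (𝓝 0) := by simpa using L.continuous.tendsto 0
  have hO : (fun p => φ (L p) - (1 / 2 : ℝ) * B (L p) (L p)) =O[𝓝 0] fun p => ‖p‖ ^ 3 := by
    refine IsBigO.trans (g := fun p => ‖L p‖ ^ 3) ?_ ((L.isBigO_id _).norm_norm.pow 3)
    simpa [Function.comp_def] using htaylor.comp_tendsto hL
  obtain ⟨K, hK, hbound⟩ := hO.exists_pos
  obtain ⟨r, hr, h⟩ := Metric.eventually_nhds_iff_ball.1 hbound.bound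
  refine ⟨K, r, hK, hr, fun x y hxy => ?_⟩
  have hle := norm_prod_pi_le_sqrt x y
  have hp := h (x, y) (mem_ball_zero_iff.2 (hle.trans_lt hxy))
  have hLp : L (x, y) = (A.mulVec x, A.mulVec y) := rfl
  rw [hLp, hquad, hBA, Real.norm_eq_abs, norm_pow, norm_norm, ← mul_assoc,
    one_div_mul_cancel two_ne_zero, one_mul] at hp
  exact hp.trans (by gcongr)
end

section
/- Define φ : ℂ³ → ℝ by φ(z₁,z₂,z₃) = (Im z₁)² + (Im z₂)² + (Im z₃ − Re z₂ · Im z₁)². Then φ is strongly plurisubharmonic at every point of ℝ³ ⊆ ℂ³ in the following sense: for every z ∈ ℂ³ with Im z₁ = Im z₂ = Im z₃ = 0 and every nonzero w ∈ ℂ³, the function ψ : ℝ² → ℝ defined by ψ(a,b) = φ(z + (a+ib)w) satisfies (∂²ψ/∂a²)(0,0) + (∂²ψ/∂b²)(0,0) > 0. -/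
open Complex

/-- The gauge function of the Grauert tube of the Heisenberg group. -/
noncomputable def heisenbergGauge (z₁ z₂ z₃ : ℂ) : ℝ :=
  z₁.im ^ 2 + z₂.im ^ 2 + (z₃.im - z₂.re * z₁.im) ^ 2

/-- The second derivative at the origin of the gauge along a real line through a point of `ℝ³`,
where `p` and `qⱼ` are the coordinates of the direction that the gauge depends on. -/
theorem deriv_deriv_gauge_along_line (x p q₁ q₂ q₃ : ℝ) :
    deriv (deriv (fun t : ℝ =>
      (t * q₁) ^ 2 + (t * q₂) ^ 2 + (t * q₃ - (x + t * p) * (t * q₁)) ^ 2)) 0 =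
      2 * (q₁ ^ 2 + q₂ ^ 2 + (q₃ - x * q₁) ^ 2) := by
  have first : deriv (fun t : ℝ =>
      (t * q₁) ^ 2 + (t * q₂) ^ 2 + (t * q₃ - (x + t * p) * (t * q₁)) ^ 2) =
      fun t => 2 * (t * q₁) * q₁ + 2 * (t * q₂) * q₂ +
        2 * (t * q₃ - (x + t * p) * (t * q₁)) * (q₃ - (p * (t * q₁) + (x + t * p) * q₁)) := by
    funext t
    have lin (c : ℝ) : HasDerivAt (fun t : ℝ => t * c) c t := hasDerivAt_mul_const c
    refine ((((lin q₁).pow 2).add ((lin q₂).pow 2)).add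
      (((lin q₃).sub (((lin p).const_add x).mul (lin q₁))).pow 2)).deriv.trans ?_
    simp
  rw [first]
  have lin (c : ℝ) : HasDerivAt (fun t : ℝ => t * c) c 0 := hasDerivAt_mul_const c
  have prod := ((lin p).const_add x).mul (lin q₁)
  have inner := (lin q₃).sub prod
  have slope := (((lin q₁).const_mul p).add (((lin p).const_add x).mul_const q₁)).const_sub q₃
  have second := ((((lin q₁).const_mul 2).mul_const q₁).add
    (((lin q₂).const_mul 2).mul_const q₂)).add ((inner.const_mul 2).mul slope)
  refine second.deriv.trans ?_
  simp
  ring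

/-- The gauge function `φ(z₁,z₂,z₃) = (Im z₁)² + (Im z₂)² + (Im z₃ − Re z₂ · Im z₁)²` is
strongly plurisubharmonic at every point of `ℝ³ ⊆ ℂ³`: for `z` with real coordinates and
`w ≠ 0`, the function `ψ(a, b) = φ(z + (a + i b) w)` satisfies
`∂²ψ/∂a²(0,0) + ∂²ψ/∂b²(0,0) > 0`. -/
theorem stmt16 (z₁ z₂ z₃ : ℂ)
    (hz₁ : z₁.im = 0) (hz₂ : z₂.im = 0) (hz₃ : z₃.im = 0)
    (w₁ w₂ w₃ : ℂ) (hw : ¬(w₁ = 0 ∧ w₂ = 0 ∧ w₃ = 0)) :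
    0 <
      deriv (deriv (fun a : ℝ =>
        heisenbergGauge (z₁ + (a : ℂ) * w₁) (z₂ + (a : ℂ) * w₂) (z₃ + (a : ℂ) * w₃))) 0 +
      deriv (deriv (fun b : ℝ =>
        heisenbergGauge (z₁ + ((b : ℂ) * I) * w₁) (z₂ + ((b : ℂ) * I) * w₂)
          (z₃ + ((b : ℂ) * I) * w₃))) 0 := by
  have real_line := deriv_deriv_gauge_along_line z₂.re w₂.re w₁.im w₂.im w₃.im
  have imag_line := deriv_deriv_gauge_along_line z₂.re (-w₂.im) w₁.re w₂.re w₃.re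
  have real_eq : (fun a : ℝ =>
      heisenbergGauge (z₁ + (a : ℂ) * w₁) (z₂ + (a : ℂ) * w₂) (z₃ + (a : ℂ) * w₃)) =
      fun t => (t * w₁.im) ^ 2 + (t * w₂.im) ^ 2 +
        (t * w₃.im - (z₂.re + t * w₂.re) * (t * w₁.im)) ^ 2 := by
    funext t
    simp [heisenbergGauge, hz₁, hz₂, hz₃]
  have imag_eq : (fun b : ℝ =>
      heisenbergGauge (z₁ + ((b : ℂ) * I) * w₁) (z₂ + ((b : ℂ) * I) * w₂)
        (z₃ + ((b : ℂ) * I) * w₃)) =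
      fun t => (t * w₁.re) ^ 2 + (t * w₂.re) ^ 2 +
        (t * w₃.re - (z₂.re + t * -w₂.im) * (t * w₁.re)) ^ 2 := by
    funext t
    simp [heisenbergGauge, hz₁, hz₂, hz₃]
  rw [real_eq, imag_eq, real_line, imag_line]
  by_contra! nonpos
  have sq_im₁ := sq_nonneg w₁.im
  have sq_im₂ := sq_nonneg w₂.im
  have sq_im₃ := sq_nonneg (w₃.im - z₂.re * w₁.im)
  have sq_re₁ := sq_nonneg w₁.re
  have sq_re₂ := sq_nonneg w₂.re
  have sq_re₃ := sq_nonneg (w₃.re - z₂.re * w₁.re)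
  have im₁ : w₁.im = 0 := sq_eq_zero_iff.mp (by linarith)
  have im₂ : w₂.im = 0 := sq_eq_zero_iff.mp (by linarith)
  have im₃ : w₃.im - z₂.re * w₁.im = 0 := sq_eq_zero_iff.mp (by linarith)
  have re₁ : w₁.re = 0 := sq_eq_zero_iff.mp (by linarith)
  have re₂ : w₂.re = 0 := sq_eq_zero_iff.mp (by linarith)
  have re₃ : w₃.re - z₂.re * w₁.re = 0 := sq_eq_zero_iff.mp (by linarith)
  rw [im₁, mul_zero, sub_zero] at im₃
  rw [re₁, mul_zero, sub_zero] at re₃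
  exact hw ⟨Complex.ext re₁ im₁, Complex.ext re₂ im₂, Complex.ext re₃ im₃⟩
end
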